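/- arXiv:2402.09152 — 2 statements merged into one kernel-verified Lean document; each statement's English description precedes it below -/
import Mathlib

section
/- (Lemma 5, second moment of a block of one-point gradient estimates) Let 𝒢 be a sub-σ-algebra of the underlying probability space, let u_1, …, u_K : Ω → 𝕊ⁿ⁻¹ be random vectors such that u_1, …, u_K and 𝒢 are mutually independent and each u_t is uniformly distributed on 𝕊ⁿ⁻¹, and let Y : Ω → 𝒦_δ be a 𝒢-measurable random vector. Let f_1, …, f_K : ℝⁿ → ℝ each be G-Lipschitz on 𝒦 with |f_t(x)| ≤ M for all x ∈ 𝒦. Then E[‖Σ_{t=1}^K (n/δ) f_t(Y + δu_t) u_t‖₂²] ≤ K(nM/δ)² + K²G². -/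
open MeasureTheory ProbabilityTheory Metric Pointwise

/-- The uniform probability measure on the unit Euclidean sphere in `ℝⁿ`
(normalized surface measure). -/
noncomputable def uniformSphere (n : ℕ) : Measure (EuclideanSpace ℝ (Fin n)) :=
  (((volume : Measure (EuclideanSpace ℝ (Fin n))).toSphere Set.univ)⁻¹) •
    Measure.map Subtype.val ((volume : Measure (EuclideanSpace ℝ (Fin n))).toSphere)

section UniformSphere

variable {n : ℕ}

local notation "E" => EuclideanSpace ℝ (Fin n)

theorem isProbabilityMeasure_uniformSphere (hn : 1 ≤ n) :
    IsProbabilityMeasure (uniformSphere n) := by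
  have : Nonempty (Fin n) := ⟨⟨0, hn⟩⟩
  have h0 : (volume : Measure E).toSphere Set.univ ≠ 0 := by
    rw [Ne, Measure.measure_univ_eq_zero]
    exact Measure.toSphere_ne_zero _
  constructor
  rw [uniformSphere, Measure.smul_apply, Measure.map_apply measurable_subtype_coe .univ,
    Set.preimage_univ, smul_eq_mul, ENNReal.inv_mul_cancel h0 (measure_ne_top _ _)]

theorem ae_norm_eq_one_uniformSphere : ∀ᵐ a ∂(uniformSphere n), ‖a‖ = 1 := by
  refine Measure.ae_smul_measure ?_ _
  rw [ae_map_iff measurable_subtype_coe.aemeasurable 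
    (measurableSet_eq_fun (by fun_prop) (by fun_prop))]
  exact .of_forall fun a => by simp

theorem measurePreserving_uniformSphere (e : E ≃ₗᵢ[ℝ] E) :
    MeasurePreserving e (uniformSphere n) (uniformSphere n) := by
  refine ⟨e.continuous.measurable, ?_⟩
  rw [uniformSphere, Measure.map_smul]
  congr 1
  ext s hs
  have he : MeasurableSet (e ⁻¹' s) := e.continuous.measurable hs
  rw [Measure.map_apply e.continuous.measurable hs, Measure.map_apply measurable_subtype_coe he,
    Measure.map_apply measurable_subtype_coe hs,
    Measure.toSphere_apply' _ (measurable_subtype_coe he),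
    Measure.toSphere_apply' _ (measurable_subtype_coe hs)]
  congr 1
  rw [Subtype.image_preimage_coe, Subtype.image_preimage_coe,
    ← e.measurePreserving.measure_preimage_equiv (f := e.toMeasurableEquiv)
      (Set.Ioo (0 : ℝ) 1 • (sphere 0 1 ∩ s))]
  congr 1
  ext x
  simp only [Set.mem_smul, Set.mem_inter_iff, Set.mem_preimage, mem_sphere_zero_iff_norm,
    LinearIsometryEquiv.coe_toMeasurableEquiv]
  constructor
  · rintro ⟨c, hc, y, ⟨hy, hys⟩, rfl⟩
    exact ⟨c, hc, e y, ⟨by simpa using hy, hys⟩, by simp⟩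
  · rintro ⟨c, hc, y, ⟨hy, hys⟩, hx⟩
    exact ⟨c, hc, e.symm y, ⟨by simpa using hy, by simpa using hys⟩, by
      rw [← map_smul, hx, e.symm_apply_apply]⟩

theorem integral_comp_uniformSphere {F : Type*} [NormedAddCommGroup F] [NormedSpace ℝ F]
    (e : E ≃ₗᵢ[ℝ] E) (g : E → F) :
    ∫ a, g (e a) ∂(uniformSphere n) = ∫ a, g a ∂(uniformSphere n) :=
  (measurePreserving_uniformSphere e).integral_comp
    e.toHomeomorph.measurableEmbedding g

theorem integrable_inner_sq_uniformSphere (hn : 1 ≤ n) {v : E} (hv : ‖v‖ = 1) :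
    Integrable (fun a => (inner ℝ v a) ^ 2) (uniformSphere n) := by
  have := isProbabilityMeasure_uniformSphere hn
  refine .of_bound (by fun_prop) 1 ?_
  filter_upwards [ae_norm_eq_one_uniformSphere] with a ha
  have := abs_real_inner_le_norm v a
  rw [hv, ha, one_mul] at this
  simpa using this

theorem integral_inner_sq_uniformSphere (hn : 1 ≤ n) {v : E} (hv : ‖v‖ = 1) :
    ∫ a, (inner ℝ v a) ^ 2 ∂(uniformSphere n) = 1 / n := by
  have := isProbabilityMeasure_uniformSphere hn
  have hrot (w : E) (hw : ‖w‖ = 1) : ∫ a, (inner ℝ w a) ^ 2 ∂(uniformSphere n)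
      = ∫ a, (inner ℝ v a) ^ 2 ∂(uniformSphere n) := by
    rw [← integral_comp_uniformSphere (ℝ ∙ (v - w))ᗮ.reflection]
    congr 1 with a
    rw [← LinearIsometryEquiv.inner_map_map (ℝ ∙ (v - w))ᗮ.reflection v a,
      Submodule.reflection_sub (hv.trans hw.symm)]
  have hsum : ∑ i : Fin n, ∫ a, (inner ℝ (EuclideanSpace.basisFun (Fin n) ℝ i) a) ^ 2
      ∂(uniformSphere n) = 1 := by
    rw [← integral_finsetSum _ fun i _ => integrable_inner_sq_uniformSphere hn (by simp)]
    rw [integral_congr_ae (g := fun _ => (1 : ℝ))]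
    · simp
    · filter_upwards [ae_norm_eq_one_uniformSphere] with a ha
      have := (EuclideanSpace.basisFun (Fin n) ℝ).sum_sq_norm_inner_right a
      simpa [ha] using this
  rw [Finset.sum_congr rfl fun i _ => hrot _ (by simp)] at hsum
  have hn' : (n : ℝ) ≠ 0 := by positivity
  field_simp
  simpa [mul_comm] using hsum

/-- The first moment of an `L`-Lipschitz function on the sphere has norm at most `L / n`. The proof
antisymmetrizes along the reflection that negates the direction of the moment. -/
theorem norm_integral_smul_uniformSphere_le (hn : 1 ≤ n) {φ : E → ℝ} {L : ℝ}
    (hφ : ∀ a b : E, ‖a‖ = 1 → ‖b‖ = 1 → |φ a - φ b| ≤ L * ‖a - b‖)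
    (hint : Integrable (fun a => φ a • a) (uniformSphere n)) (hL : 0 ≤ L) :
    ‖∫ a, φ a • a ∂(uniformSphere n)‖ ≤ L / n := by
  have := isProbabilityMeasure_uniformSphere hn
  set w := ∫ a, φ a • a ∂(uniformSphere n) with hw
  by_cases h0 : w = 0
  · rw [h0, norm_zero]; positivity
  set v : E := ‖w‖⁻¹ • w with hv
  have hw0 : ‖w‖ ≠ 0 := norm_ne_zero_iff.2 h0
  have hv1 : ‖v‖ = 1 := by rw [hv, norm_smul, norm_inv, norm_norm, inv_mul_cancel₀ hw0]
  have hvw : inner ℝ v w = ‖w‖ := by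
    rw [hv, real_inner_smul_left, real_inner_self_eq_norm_sq]; field_simp
  set e : E ≃ₗᵢ[ℝ] E := (ℝ ∙ v)ᗮ.reflection with he
  have hev : e v = -v := Submodule.reflection_orthogonalComplement_singleton_eq_neg v
  have hea (a : E) : a - e a = (2 * inner ℝ v a) • v := by
    rw [he, Submodule.reflection_orthogonal_apply, Submodule.reflection_singleton_apply, hv1]
    simp [mul_smul, two_smul]
  have hie (a : E) : inner ℝ v (e a) = - inner ℝ v a := by
    rw [← neg_neg v, ← hev, inner_neg_left, e.inner_map_map, hev, neg_neg]
  have hI : Integrable (fun a => inner ℝ v (φ a • a)) (uniformSphere n) := hint.const_inner v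
  have hI' : Integrable (fun a => inner ℝ v (φ (e a) • e a)) (uniformSphere n) :=
    (measurePreserving_uniformSphere e).integrable_comp_of_integrable hI
  have h1 : ∫ a, inner ℝ v (φ a • a) ∂(uniformSphere n) = ‖w‖ := by
    rw [integral_inner hint, hvw]
  have h2 : ∫ a, inner ℝ v (φ (e a) • e a) ∂(uniformSphere n) = ‖w‖ := by
    rw [integral_comp_uniformSphere e fun a => inner ℝ v (φ a • a), h1]
  have h3 : 2 * ‖w‖ ≤ ∫ a, 2 * L * (inner ℝ v a) ^ 2 ∂(uniformSphere n) := by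
    rw [two_mul]
    nth_rw 1 [← h1]
    rw [← h2, ← integral_add hI hI']
    refine integral_mono_ae (hI.add hI')
      ((integrable_inner_sq_uniformSphere hn hv1).const_mul (2 * L)) ?_
    filter_upwards [ae_norm_eq_one_uniformSphere] with a ha
    have hle := hφ a (e a) ha (by rw [e.norm_map, ha])
    rw [hea, norm_smul, hv1, mul_one, Real.norm_eq_abs, abs_mul, abs_two] at hle
    simp only [real_inner_smul_right, hie]
    calc φ a * inner ℝ v a + φ (e a) * -inner ℝ v a = (φ a - φ (e a)) * inner ℝ v a := by ring
      _ ≤ |φ a - φ (e a)| * |inner ℝ v a| := (le_abs_self _).trans (abs_mul _ _).le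
      _ ≤ L * (2 * |inner ℝ v a|) * |inner ℝ v a| := by gcongr
      _ = 2 * L * |inner ℝ v a| ^ 2 := by ring
      _ = 2 * L * (inner ℝ v a) ^ 2 := by rw [sq_abs]
  rw [integral_const_mul, integral_inner_sq_uniformSphere hn hv1] at h3
  linarith [show 2 * L * (1 / (n : ℝ)) = 2 * (L / n) by ring]

end UniformSphere

/-- If `Y`, `U`, `V` are independent, the correlation of `g (Y, U)` and `h (Y, V)` is controlled by
the conditional means given `Y`. -/
theorem integral_inner_le_of_indepFun {Ω 𝓨 𝓤 𝓥 F : Type*} [MeasurableSpace Ω]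
    [MeasurableSpace 𝓨] [MeasurableSpace 𝓤] [MeasurableSpace 𝓥]
    [NormedAddCommGroup F] [InnerProductSpace ℝ F] [CompleteSpace F]
    [MeasurableSpace F] [BorelSpace F] [SecondCountableTopology F]
    {μ : Measure Ω} [IsProbabilityMeasure μ] {Y : Ω → 𝓨} {U : Ω → 𝓤} {V : Ω → 𝓥}
    (hY : Measurable Y) (hU : Measurable U) (hV : Measurable V)
    (hYU : IndepFun Y U μ) (hYV : IndepFun Y V μ) (hYUV : IndepFun (fun ω => (Y ω, U ω)) V μ)
    {g : 𝓨 × 𝓤 → F} {h : 𝓨 × 𝓥 → F} (hg : Measurable g) (hh : Measurable h)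
    {C D B₁ B₂ : ℝ} (hgC : ∀ ω, ‖g (Y ω, U ω)‖ ≤ C) (hhD : ∀ ω, ‖h (Y ω, V ω)‖ ≤ D)
    (hgB : ∀ᵐ y ∂(μ.map Y), ‖∫ a, g (y, a) ∂(μ.map U)‖ ≤ B₁)
    (hhB : ∀ᵐ y ∂(μ.map Y), ‖∫ a, h (y, a) ∂(μ.map V)‖ ≤ B₂) :
    ∫ ω, inner ℝ (g (Y ω, U ω)) (h (Y ω, V ω)) ∂μ ≤ B₁ * B₂ := by
  have := Measure.isProbabilityMeasure_map (μ := μ) hY.aemeasurable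
  have := Measure.isProbabilityMeasure_map (μ := μ) hU.aemeasurable
  have := Measure.isProbabilityMeasure_map (μ := μ) hV.aemeasurable
  have hYUmap := (indepFun_iff_map_prod_eq_prod_map_map hY.aemeasurable hU.aemeasurable).1 hYU
  have hYVmap := (indepFun_iff_map_prod_eq_prod_map_map hY.aemeasurable hV.aemeasurable).1 hYV
  have hmap := (indepFun_iff_map_prod_eq_prod_map_map (hY.prodMk hU).aemeasurable
    hV.aemeasurable).1 hYUV
  rw [hYUmap] at hmap
  set Φ : (𝓨 × 𝓤) × 𝓥 → ℝ := fun p => inner ℝ (g p.1) (h (p.1.1, p.2)) with hΦ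
  have hΦm : Measurable Φ := by fun_prop
  have hT : Measurable fun ω => ((Y ω, U ω), V ω) := by fun_prop
  have hgi : Integrable g ((μ.map Y).prod (μ.map U)) := by
    rw [← hYUmap, integrable_map_measure hg.aestronglyMeasurable (by fun_prop)]
    exact .of_bound (hg.comp (hY.prodMk hU)).aestronglyMeasurable C (.of_forall hgC)
  have hhi : Integrable h ((μ.map Y).prod (μ.map V)) := by
    rw [← hYVmap, integrable_map_measure hh.aestronglyMeasurable (by fun_prop)]
    exact .of_bound (hh.comp (hY.prodMk hV)).aestronglyMeasurable D (.of_forall hhD)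
  have hΦi : Integrable Φ (((μ.map Y).prod (μ.map U)).prod (μ.map V)) := by
    rw [← hmap, integrable_map_measure hΦm.aestronglyMeasurable hT.aemeasurable]
    refine .of_bound (hΦm.comp hT).aestronglyMeasurable (C * D) (.of_forall fun ω => ?_)
    refine (norm_inner_le_norm _ _).trans ?_
    exact mul_le_mul (hgC ω) (hhD ω) (norm_nonneg _) ((norm_nonneg _).trans (hgC ω))
  have h1 : ∫ ω, inner ℝ (g (Y ω, U ω)) (h (Y ω, V ω)) ∂μ =
      ∫ p, Φ p ∂(((μ.map Y).prod (μ.map U)).prod (μ.map V)) := by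
    rw [← hmap, integral_map hT.aemeasurable hΦm.aestronglyMeasurable]
  have h2 : (fun q => ∫ v, Φ (q, v) ∂(μ.map V)) =ᵐ[(μ.map Y).prod (μ.map U)]
      fun q => inner ℝ (g q) (∫ v, h (q.1, v) ∂(μ.map V)) := by
    filter_upwards [Measure.quasiMeasurePreserving_fst.ae hhi.prod_right_ae] with q hq
    exact integral_inner (𝕜 := ℝ) hq (g q)
  have h3 := hΦi.integral_prod_left.congr h2
  rw [h1, integral_prod _ hΦi, integral_congr_ae h2, integral_prod _ h3]
  refine (integral_mono_ae h3.integral_prod_left (integrable_const (B₁ * B₂)) ?_).trans (by simp)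
  filter_upwards [hgi.prod_right_ae, hgB, hhB] with y hy hy₁ hy₂
  simp only [real_inner_comm (∫ v, h (y, v) ∂(μ.map V))]
  rw [integral_inner hy]
  refine (real_inner_le_norm _ _).trans ?_
  rw [mul_comm]
  exact mul_le_mul hy₁ hy₂ (norm_nonneg _) ((norm_nonneg _).trans hy₁)

/-- Lemma 5 (second moment of a block of one-point gradient estimates): if
`u_1, …, u_K` are uniform on `𝕊ⁿ⁻¹`, mutually independent together with a sub-σ-algebra
`𝒢`, `Y` is `𝒢`-measurable with values in `𝒦_δ = (1 − δ/r)𝒦`, and each `f t` is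
`G`-Lipschitz and bounded by `M` on `𝒦`, then
`E[‖∑_t (n/δ) f_t(Y + δ u_t) u_t‖²] ≤ K(nM/δ)² + K²G²`. -/
theorem second_moment_of_block (n : ℕ) (hn : 1 ≤ n)
    (𝒦 : Set (EuclideanSpace ℝ (Fin n))) (hconv : Convex ℝ 𝒦) (hcomp : IsCompact 𝒦)
    (r R : ℝ) (hr : 0 < r) (hrR : r ≤ R)
    (hin : closedBall (0 : EuclideanSpace ℝ (Fin n)) r ⊆ 𝒦)
    (hout : 𝒦 ⊆ closedBall (0 : EuclideanSpace ℝ (Fin n)) R)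
    (δ : ℝ) (hδ : 0 < δ) (hδr : δ < r)
    (G M : ℝ)
    {Ω : Type} (𝒢 : MeasurableSpace Ω) [m0 : MeasurableSpace Ω]
    (μ : Measure Ω) [IsProbabilityMeasure μ] (h𝒢 : 𝒢 ≤ m0)
    (K : ℕ) (hK : 0 < K)
    (u : Fin K → Ω → EuclideanSpace ℝ (Fin n))
    (humeas : ∀ t, Measurable (u t))
    (husph : ∀ t, ∀ ω, ‖u t ω‖ = 1)
    (hudist : ∀ t, Measure.map (u t) μ = uniformSphere n)
    (hindep : iIndep
      (fun i : Option (Fin K) =>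
        Option.elim i 𝒢 fun t =>
          MeasurableSpace.comap (u t)
            (inferInstance : MeasurableSpace (EuclideanSpace ℝ (Fin n)))) μ)
    (Y : Ω → EuclideanSpace ℝ (Fin n))
    (hY𝒢 : Measurable[𝒢] Y)
    (hYmem : ∀ ω, Y ω ∈ (1 - δ/r) • 𝒦)
    (f : Fin K → EuclideanSpace ℝ (Fin n) → ℝ)
    (hlip : ∀ t, ∀ x ∈ 𝒦, ∀ y ∈ 𝒦, |f t x - f t y| ≤ G * ‖x - y‖)
    (hbdd : ∀ t, ∀ x ∈ 𝒦, |f t x| ≤ M) :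
    ∫ ω, ‖∑ t : Fin K, (((n : ℝ)/δ) * f t (Y ω + δ • u t ω)) • u t ω‖^2 ∂μ
      ≤ (K : ℝ) * ((n : ℝ) * M / δ)^2 + (K : ℝ)^2 * G^2 := by
  have hδr_pos : 0 < δ / r := by positivity
  have hr1 : δ / r < 1 := (div_lt_one hr).2 hδr
  have hzero : (0 : EuclideanSpace ℝ (Fin n)) ∈ 𝒦 := hin (by simp [hr.le])
  have hM : 0 ≤ M := (abs_nonneg _).trans (hbdd ⟨0, hK⟩ 0 hzero)
  have hG : 0 ≤ G := by
    set x : EuclideanSpace ℝ (Fin n) := EuclideanSpace.single ⟨0, hn⟩ r with hx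
    have hxn : ‖x‖ = r := by simp [hx, abs_of_pos hr]
    have := (abs_nonneg _).trans (hlip ⟨0, hK⟩ x (hin (by simp [hxn])) 0 hzero)
    rw [sub_zero, hxn] at this
    exact nonneg_of_mul_nonneg_left this hr
  have hmem {y a : EuclideanSpace ℝ (Fin n)} (hy : y ∈ (1 - δ / r) • 𝒦) (ha : ‖a‖ = 1) :
      y + δ • a ∈ 𝒦 := by
    obtain ⟨k, hk, rfl⟩ := hy
    have hra : r • a ∈ 𝒦 := hin (by simp [norm_smul, ha, abs_of_pos hr])
    have := hconv hk hra (sub_nonneg.2 hr1.le) hδr_pos.le (by ring)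
    rwa [smul_smul, div_mul_cancel₀ _ hr.ne'] at this
  have hY : Measurable Y := hY𝒢.mono h𝒢 le_rfl
  have hn0 : (0 : ℝ) < n := by exact_mod_cast hn
  have hFm (t : Fin K) : Measurable (𝒦.indicator (f t)) := by
    have hc : ContinuousOn (f t) 𝒦 := by
      refine LipschitzOnWith.continuousOn (K := G.toNNReal) (.of_dist_le_mul fun x hx y hy => ?_)
      rw [Real.dist_eq, dist_eq_norm, Real.coe_toNNReal _ hG]
      exact hlip t x hx y hy
    classical
    rw [← Set.piecewise_eq_indicator]
    exact hc.measurable_piecewise continuousOn_const hcomp.measurableSet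
  set g : Fin K → EuclideanSpace ℝ (Fin n) × EuclideanSpace ℝ (Fin n) → EuclideanSpace ℝ (Fin n) :=
    fun t p => ((n : ℝ) / δ * 𝒦.indicator (f t) (p.1 + δ • p.2)) • p.2 with hg
  have hgm (t : Fin K) : Measurable (g t) :=
    (((hFm t).comp (by fun_prop)).const_mul _).smul measurable_snd
  have hgC (t : Fin K) {y a : EuclideanSpace ℝ (Fin n)} (hy : y ∈ (1 - δ / r) • 𝒦)
      (ha : ‖a‖ = 1) : ‖g t (y, a)‖ ≤ n * M / δ := by
    simp only [hg, norm_smul, ha, mul_one, Set.indicator_of_mem (hmem hy ha), norm_mul, norm_div,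
      Real.norm_eq_abs, abs_of_pos hδ, abs_of_pos hn0]
    rw [div_mul_eq_mul_div]
    gcongr
    exact hbdd t _ (hmem hy ha)
  have hprob := isProbabilityMeasure_uniformSphere hn
  have hmean (t : Fin K) : ∀ᵐ y ∂(μ.map Y), ‖∫ a, g t (y, a) ∂(μ.map (u t))‖ ≤ G := by
    have hD : MeasurableSet ((1 - δ / r) • 𝒦) := (hcomp.smul _).measurableSet
    have hYD : ∀ᵐ y ∂(μ.map Y), y ∈ (1 - δ / r) • 𝒦 :=
      (ae_map_iff hY.aemeasurable hD).2 (.of_forall hYmem)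
    filter_upwards [hYD] with y hy
    rw [hudist]
    refine (norm_integral_smul_uniformSphere_le hn (L := n * G)
      (φ := fun a => (n : ℝ) / δ * 𝒦.indicator (f t) (y + δ • a)) ?_ ?_ (by positivity)).trans_eq
      (by field_simp)
    · intro a b ha hb
      have := hlip t _ (hmem hy ha) _ (hmem hy hb)
      rw [add_sub_add_left_eq_sub, ← smul_sub, norm_smul, Real.norm_eq_abs, abs_of_pos hδ] at this
      rw [Set.indicator_of_mem (hmem hy ha), Set.indicator_of_mem (hmem hy hb), ← mul_sub, abs_mul,
        abs_of_pos (by positivity : (n : ℝ) / δ > 0)]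
      calc (n : ℝ) / δ * |f t (y + δ • a) - f t (y + δ • b)|
          ≤ (n : ℝ) / δ * (G * (δ * ‖a - b‖)) := by gcongr
        _ = n * G * ‖a - b‖ := by field_simp
    · refine .of_bound ((hgm t).comp (measurable_prodMk_left (x := y))).aestronglyMeasurable
        (n * M / δ) ?_
      filter_upwards [ae_norm_eq_one_uniformSphere] with a ha using hgC t hy ha
  set Z : Option (Fin K) → Ω → EuclideanSpace ℝ (Fin n) := fun i => i.elim Y u with hZ
  have hZm (i : Option (Fin K)) : Measurable (Z i) := by
    cases i with
    | none => exact hY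
    | some t => exact humeas t
  have hZind : iIndepFun Z μ := by
    rw [iIndepFun_iff_iIndep]
    refine iIndep_of_iIndep_of_le hindep fun i => ?_
    cases i with
    | none => exact hY𝒢.comap_le
    | some t => exact le_rfl
  have hgi (s t : Fin K) :
      Integrable (fun ω => inner ℝ (g s (Y ω, u s ω)) (g t (Y ω, u t ω))) μ := by
    refine .of_bound (Measurable.aestronglyMeasurable ?_) ((n * M / δ) * (n * M / δ))
      (.of_forall fun ω => (norm_inner_le_norm _ _).trans ?_)
    · exact ((hgm s).comp (hY.prodMk (humeas s))).inner ((hgm t).comp (hY.prodMk (humeas t)))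
    · exact mul_le_mul (hgC s (hYmem ω) (husph s ω)) (hgC t (hYmem ω) (husph t ω))
        (norm_nonneg _) (by positivity)
  have hpair (s t : Fin K) : ∫ ω, inner ℝ (g s (Y ω, u s ω)) (g t (Y ω, u t ω)) ∂μ ≤
      (if s = t then (n * M / δ) ^ 2 else 0) + G ^ 2 := by
    split_ifs with hst
    · subst hst
      refine (integral_mono (hgi s s) (integrable_const ((n * M / δ) ^ 2)) fun ω => ?_).trans ?_
      · simp only [real_inner_self_eq_norm_sq]
        gcongr
        exact hgC s (hYmem ω) (husph s ω)
      · simp [sq_nonneg]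
    · rw [zero_add, sq]
      exact integral_inner_le_of_indepFun hY (humeas s) (humeas t)
        (hZind.indepFun (i := none) (j := some s) (by simp))
        (hZind.indepFun (i := none) (j := some t) (by simp))
        (hZind.indepFun_prodMk hZm none (some s) (some t) (by simp) (by simpa using hst))
        (hgm s) (hgm t) (fun ω => hgC s (hYmem ω) (husph s ω))
        (fun ω => hgC t (hYmem ω) (husph t ω)) (hmean s) (hmean t)
  have hexp (ω : Ω) : ‖∑ t : Fin K, (((n : ℝ)/δ) * f t (Y ω + δ • u t ω)) • u t ω‖^2 =
      ∑ s, ∑ t, inner ℝ (g s (Y ω, u s ω)) (g t (Y ω, u t ω)) := by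
    have hgf (t : Fin K) : (((n : ℝ)/δ) * f t (Y ω + δ • u t ω)) • u t ω = g t (Y ω, u t ω) := by
      simp only [hg, Set.indicator_of_mem (hmem (hYmem ω) (husph t ω))]
    simp_rw [hgf, ← real_inner_self_eq_norm_sq, sum_inner, inner_sum]
  simp_rw [hexp]
  rw [integral_finsetSum _ fun s _ => integrable_finsetSum _ fun t _ => hgi s t]
  simp_rw [integral_finsetSum _ fun t _ => hgi _ t]
  refine (Finset.sum_le_sum fun s _ => Finset.sum_le_sum fun t _ => hpair s t).trans_eq ?_
  simp [Finset.sum_add_distrib]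
  ring
end

section
/- (Lemma 1, one-point gradient estimator) Let f : ℝⁿ → ℝ be Lipschitz continuous and let δ ∈ (0, 1). Then for every x ∈ ℝⁿ, the δ-smoothed version f̂_δ is differentiable at x and its gradient satisfies ∇f̂_δ(x) = E_{u∼Unif(𝕊ⁿ⁻¹)}[(n/δ) f(x + δu) u], where the expectation is with respect to the uniform probability measure on the unit sphere 𝕊ⁿ⁻¹. -/
open MeasureTheory Metric

/-- The uniform probability measure on the closed unit Euclidean ball in `ℝⁿ`. -/
noncomputable def uniformBall (n : ℕ) : Measure (EuclideanSpace ℝ (Fin n)) :=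
  ((volume (closedBall (0 : EuclideanSpace ℝ (Fin n)) 1))⁻¹) •
    (volume.restrict (closedBall (0 : EuclideanSpace ℝ (Fin n)) 1))

/-- The `δ`-smoothed version `f̂_δ(x) = E_{u ∼ Unif(𝔹ⁿ)}[f(x + δu)]`. -/
noncomputable def smoothed (n : ℕ) (f : EuclideanSpace ℝ (Fin n) → ℝ) (δ : ℝ)
    (x : EuclideanSpace ℝ (Fin n)) : ℝ :=
  ∫ u, f (x + δ • u) ∂(uniformBall n)

open Set Filter Topology
open scoped NNReal RealInnerProductSpace

section Polar

variable {E : Type*} [NormedAddCommGroup E] [NormedSpace ℝ E] [FiniteDimensional ℝ E]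
  [Nontrivial E] [MeasurableSpace E] [BorelSpace E] (μ : Measure E) [μ.IsAddHaarMeasure]

/-- Integration in polar coordinates. -/
theorem integral_eq_integral_Ioi_toSphere {h : E → ℝ} (hh : Integrable h μ) :
    ∫ x, h x ∂μ = ∫ r in Ioi (0 : ℝ), r ^ (Module.finrank ℝ E - 1) *
      ∫ ω : sphere (0 : E) 1, h (r • (ω : E)) ∂μ.toSphere := by
  have hmp := μ.measurePreserving_homeomorphUnitSphereProd
  have hemb := (homeomorphUnitSphereProd E).measurableEmbedding
  have hval : ∀ y : ({(0 : E)}ᶜ : Set E), h ((homeomorphUnitSphereProd E y).2.1 •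
      ((homeomorphUnitSphereProd E y).1 : E)) = h y := by
    intro y
    rw [← homeomorphUnitSphereProd_symm_apply_coe, Homeomorph.symm_apply_apply]
  have hint : Integrable (fun p : sphere (0 : E) 1 × Ioi (0 : ℝ) ↦ h (p.2.1 • (p.1 : E)))
      (μ.toSphere.prod (.volumeIoiPow (Module.finrank ℝ E - 1))) := by
    rw [← hmp.integrable_comp_emb hemb]
    have : (fun p : sphere (0 : E) 1 × Ioi (0 : ℝ) ↦ h (p.2.1 • (p.1 : E))) ∘
        homeomorphUnitSphereProd E = h ∘ Subtype.val := funext hval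
    rw [this]
    exact ((MeasurableEmbedding.subtype_coe
      (measurableSet_singleton _).compl).integrable_map_iff).1 (by
        rw [map_comap_subtype_coe (measurableSet_singleton _).compl]
        exact hh.restrict)
  calc
    ∫ x, h x ∂μ = ∫ x : ({(0)}ᶜ : Set E), h x.1 ∂(μ.comap (↑)) := by
      rw [integral_subtype_comap (measurableSet_singleton _).compl h,
        restrict_compl_singleton]
    _ = ∫ p, h (p.2.1 • (p.1 : E))
          ∂μ.toSphere.prod (.volumeIoiPow (Module.finrank ℝ E - 1)) := by
      rw [← hmp.integral_comp hemb]
      simp only [hval]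
    _ = ∫ r : Ioi (0 : ℝ), ∫ ω : sphere (0 : E) 1, h (r.1 • (ω : E)) ∂μ.toSphere
          ∂.volumeIoiPow (Module.finrank ℝ E - 1) := integral_prod_symm _ hint
    _ = _ := by
      simp only [Measure.volumeIoiPow, ENNReal.ofReal]
      rw [integral_withDensity_eq_integral_smul,
        integral_subtype_comap measurableSet_Ioi fun a ↦
          Real.toNNReal (a ^ (Module.finrank ℝ E - 1)) •
            ∫ ω : sphere (0 : E) 1, h (a • (ω : E)) ∂μ.toSphere,
        setIntegral_congr_fun measurableSet_Ioi fun x hx ↦ ?_]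
      · rw [NNReal.smul_def, Real.coe_toNNReal _ (pow_nonneg (mem_Ioi.1 hx).le _), smul_eq_mul]
      · exact (measurable_subtype_coe.pow_const _).real_toNNReal

end Polar

theorem hasDerivAt_max_sub_zero {a r : ℝ} (h : a ≠ r) :
    HasDerivAt (fun s : ℝ ↦ max (s - a) 0) (if a < r then 1 else 0) r := by
  rcases h.lt_or_gt with h | h
  · rw [if_pos h]
    refine ((hasDerivAt_id r).sub_const a).congr_of_eventuallyEq ?_
    filter_upwards [lt_mem_nhds h] with s hs
    exact max_eq_left (sub_nonneg.2 hs.le)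
  · rw [if_neg h.not_gt]
    refine (hasDerivAt_const r (0 : ℝ)).congr_of_eventuallyEq ?_
    filter_upwards [gt_mem_nhds h] with s hs
    exact max_eq_right (sub_nonpos.2 hs.le)

theorem lipschitzWith_max_sub_zero (a : ℝ) : LipschitzWith 1 fun s : ℝ ↦ max (s - a) 0 := by
  simpa using (LipschitzWith.id.sub (LipschitzWith.const a)).max_const 0

section Divergence

variable {E : Type*} [NormedAddCommGroup E] [InnerProductSpace ℝ E]

theorem hasLineDerivAt_norm {u : E} (hu : u ≠ 0) (v : E) :
    HasLineDerivAt ℝ (fun x : E ↦ ‖x‖) (⟪u, v⟫ / ‖u‖) u v := by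
  have h1 : HasDerivAt (fun t : ℝ ↦ u + t • v) v 0 := by
    simpa using ((hasDerivAt_id (0 : ℝ)).smul_const v).const_add u
  have h2 := h1.norm_sq.sqrt (by simpa using hu)
  simp only [zero_smul, add_zero, Real.sqrt_sq (norm_nonneg _)] at h2
  rwa [mul_div_mul_left _ _ two_ne_zero] at h2

theorem lineDeriv_max_sub_norm {u : E} (hu : u ≠ 0) {R : ℝ} (hR : ‖u‖ ≠ R) (v : E) :
    lineDeriv ℝ (fun x : E ↦ max (R - ‖x‖) 0) u v =
      if ‖u‖ < R then -(⟪u, v⟫ / ‖u‖) else 0 := by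
  have h0 := hasDerivAt_max_sub_zero (a := 0) (r := R - ‖u‖) (sub_ne_zero.2 hR.symm).symm
  simp only [sub_zero, sub_pos] at h0
  have h1 : HasDerivAt (fun t : ℝ ↦ R - ‖u + t • v‖) (-(⟪u, v⟫ / ‖u‖)) 0 :=
    HasDerivAt.const_sub R (hasLineDerivAt_norm hu v)
  have h2 : HasLineDerivAt ℝ (fun x : E ↦ max (R - ‖x‖) 0)
      ((if ‖u‖ < R then 1 else 0) * -(⟪u, v⟫ / ‖u‖)) u v :=
    HasDerivAt.comp (0 : ℝ) (h₂ := fun s : ℝ ↦ max s 0) (by simpa using h0) h1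
  rw [h2.lineDeriv]
  split_ifs <;> simp

variable [FiniteDimensional ℝ E]
  [MeasurableSpace E] [BorelSpace E] (μ : Measure E) [μ.IsAddHaarMeasure]

theorem continuous_integral_toSphere {g : E → ℝ} (hg : Continuous g) (v : E) :
    Continuous fun r : ℝ ↦ ∫ ω : sphere (0 : E) 1, g (r • (ω : E)) * ⟪(ω : E), v⟫ ∂μ.toSphere := by
  have : Continuous (Function.uncurry fun (r : ℝ) (ω : sphere (0 : E) 1) ↦
      g (r • (ω : E)) * ⟪(ω : E), v⟫) := by
    unfold Function.uncurry
    fun_prop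
  simpa using continuous_parametric_integral_of_continuous (μ := μ.toSphere) this isCompact_univ

variable [Nontrivial E]

theorem integral_lineDeriv_mul_max_sub_norm {C : ℝ≥0} {g : E → ℝ} (hg : LipschitzWith C g)
    (v : E) {R : ℝ} (hR : 0 < R) :
    ∫ u, lineDeriv ℝ g u v * max (R - ‖u‖) 0 ∂μ =
      ∫ r in (0 : ℝ)..R, r ^ (Module.finrank ℝ E - 1) *
        ∫ ω : sphere (0 : E) 1, g (r • (ω : E)) * ⟪(ω : E), v⟫ ∂μ.toSphere := by
  have hlip : LipschitzWith 1 fun u : E ↦ max (R - ‖u‖) 0 := by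
    simpa using ((LipschitzWith.const R).sub lipschitzWith_one_norm).max_const 0
  have hsupp : HasCompactSupport fun u : E ↦ max (R - ‖u‖) 0 := by
    refine HasCompactSupport.intro (isCompact_closedBall (0 : E) R) fun u hu ↦ ?_
    rw [mem_closedBall_zero_iff, not_le] at hu
    exact max_eq_right (sub_nonpos.2 hu.le)
  have hint : Integrable (fun u : E ↦ (ball (0 : E) R).indicator
      (fun u ↦ g u * (⟪u, v⟫ / ‖u‖)) u) μ := by
    rw [integrable_indicator_iff measurableSet_ball]
    have hgi : IntegrableOn g (ball 0 R) μ :=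
      (hg.continuous.continuousOn.integrableOn_compact (isCompact_closedBall 0 R)).mono_set
        ball_subset_closedBall
    refine Integrable.mul_bdd (c := ‖v‖) hgi ?_ (.of_forall fun u ↦ ?_)
    · have : Measurable fun u : E ↦ ⟪u, v⟫ / ‖u‖ := by fun_prop
      exact this.aestronglyMeasurable
    · rw [norm_div, norm_norm]
      exact div_le_of_le_mul₀ (norm_nonneg _) (norm_nonneg _)
        ((norm_inner_le_norm u v).trans_eq (mul_comm _ _))
  calc
    ∫ u, lineDeriv ℝ g u v * max (R - ‖u‖) 0 ∂μ
      = ∫ u, lineDeriv ℝ (fun u : E ↦ max (R - ‖u‖) 0) u (-v) * g u ∂μ :=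
        hg.integral_lineDeriv_mul_eq hlip hsupp v
    _ = ∫ u, (ball (0 : E) R).indicator (fun u ↦ g u * (⟪u, v⟫ / ‖u‖)) u ∂μ := by
      refine integral_congr_ae ?_
      have h1 : ∀ᵐ u ∂μ, u ≠ 0 := Measure.ae_ne μ 0
      have h2 : ∀ᵐ u ∂μ, u ∉ sphere (0 : E) R :=
        measure_eq_zero_iff_ae_notMem.1 (Measure.addHaar_sphere μ 0 R)
      filter_upwards [h1, h2] with u hu0 huR
      rw [lineDeriv_max_sub_norm hu0 (by simpa using huR)]
      by_cases h : ‖u‖ < R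
      · simp [h, neg_div, mul_comm]
      · simp [h]
    _ = ∫ r in Ioi (0 : ℝ), r ^ (Module.finrank ℝ E - 1) * ∫ ω : sphere (0 : E) 1,
          (ball (0 : E) R).indicator (fun u ↦ g u * (⟪u, v⟫ / ‖u‖)) (r • (ω : E)) ∂μ.toSphere :=
      integral_eq_integral_Ioi_toSphere μ hint
    _ = ∫ r in Ioi (0 : ℝ), (Iio R).indicator (fun r ↦ r ^ (Module.finrank ℝ E - 1) *
          ∫ ω : sphere (0 : E) 1, g (r • (ω : E)) * ⟪(ω : E), v⟫ ∂μ.toSphere) r := by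
      refine setIntegral_congr_fun measurableSet_Ioi fun r hr ↦ ?_
      have hr0 : 0 < r := hr
      have hnorm : ∀ ω : sphere (0 : E) 1, ‖r • (ω : E)‖ = r := fun ω ↦ by
        simp [norm_smul, abs_of_pos hr0]
      by_cases h : r < R
      · simp only [indicator, mem_ball_zero_iff, hnorm, h, mem_Iio, if_true, inner_smul_left,
          RCLike.conj_to_real, mul_div_cancel_left₀ _ hr0.ne']
      · simp [indicator, hnorm, h]
    _ = _ := by
      rw [setIntegral_indicator measurableSet_Iio, Ioi_inter_Iio,
        intervalIntegral.integral_of_le hR.le, integral_Ioc_eq_integral_Ioo]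

/-- The divergence theorem on the unit ball for Lipschitz functions. -/
theorem setIntegral_ball_lineDeriv_eq {C : ℝ≥0} {g : E → ℝ} (hg : LipschitzWith C g) (v : E) :
    ∫ u in ball (0 : E) 1, lineDeriv ℝ g u v ∂μ =
      ∫ ω : sphere (0 : E) 1, g ω * ⟪(ω : E), v⟫ ∂μ.toSphere := by
  have hfin : IsFiniteMeasure (μ.restrict (ball (0 : E) 2)) :=
    ⟨by simpa using measure_ball_lt_top⟩
  have hmeas : AEStronglyMeasurable (fun u ↦ lineDeriv ℝ g u v) (μ.restrict (ball (0 : E) 2)) :=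
    aestronglyMeasurable_lineDeriv hg.continuous _
  have hbound : ∀ u, ‖lineDeriv ℝ g u v‖ ≤ C * ‖v‖ := fun u ↦
    norm_lineDeriv_le_of_lipschitz ℝ hg
  have hmax (R : ℝ) : Continuous fun u : E ↦ max (R - ‖u‖) 0 := by fun_prop
  have hL : HasDerivAt (fun R : ℝ ↦ ∫ u in ball (0 : E) 2, lineDeriv ℝ g u v * max (R - ‖u‖) 0 ∂μ)
      (∫ u in ball (0 : E) 2, lineDeriv ℝ g u v * (if ‖u‖ < 1 then 1 else 0) ∂μ) 1 := by
    refine (hasDerivAt_integral_of_dominated_loc_of_lip (bound := fun _ ↦ C * ‖v‖) univ_mem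
      (.of_forall fun R ↦ hmeas.mul (hmax R).aestronglyMeasurable) ?_ (hmeas.mul ?_) ?_
      (integrable_const _) ?_).2
    · refine Integrable.of_bound (hmeas.mul (hmax 1).aestronglyMeasurable) (C * ‖v‖ * 1)
        (.of_forall fun u ↦ ?_)
      rw [Pi.mul_apply, norm_mul]
      refine mul_le_mul (hbound u) ?_ (norm_nonneg _) (by positivity)
      rw [Real.norm_of_nonneg (le_max_right _ _)]
      exact max_le (by linarith [norm_nonneg u]) zero_le_one
    · exact (Measurable.ite (measurableSet_lt measurable_norm measurable_const)
        measurable_const measurable_const).aestronglyMeasurable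
    · refine .of_forall fun u ↦ LipschitzWith.lipschitzOnWith ?_
      refine LipschitzWith.of_dist_le_mul fun a b ↦ ?_
      rw [dist_eq_norm, Pi.mul_apply, Pi.mul_apply, ← mul_sub, norm_mul, Real.coe_nnabs,
        abs_of_nonneg (by positivity : (0 : ℝ) ≤ C * ‖v‖)]
      refine mul_le_mul (hbound u) ?_ (norm_nonneg _) (by positivity)
      simpa [dist_eq_norm] using (lipschitzWith_max_sub_zero ‖u‖).dist_le_mul a b
    · have h2 : ∀ᵐ u ∂μ, u ∉ sphere (0 : E) 1 :=
        measure_eq_zero_iff_ae_notMem.1 (Measure.addHaar_sphere μ 0 1)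
      filter_upwards [ae_restrict_of_ae h2] with u hu
      exact (hasDerivAt_max_sub_zero (by simpa using hu)).const_mul _
  have hcont : Continuous fun r : ℝ ↦ r ^ (Module.finrank ℝ E - 1) *
        ∫ ω : sphere (0 : E) 1, g (r • (ω : E)) * ⟪(ω : E), v⟫ ∂μ.toSphere :=
    (continuous_pow _).mul (continuous_integral_toSphere μ hg.continuous v)
  have hR := hcont.integral_hasStrictDerivAt 0 1 |>.hasDerivAt
  have heq : (fun R : ℝ ↦ ∫ u in ball (0 : E) 2, lineDeriv ℝ g u v * max (R - ‖u‖) 0 ∂μ)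
      =ᶠ[𝓝 1] fun R ↦ ∫ r in (0 : ℝ)..R, r ^ (Module.finrank ℝ E - 1) *
        ∫ ω : sphere (0 : E) 1, g (r • (ω : E)) * ⟪(ω : E), v⟫ ∂μ.toSphere := by
    filter_upwards [Ioo_mem_nhds zero_lt_one one_lt_two] with R hR
    rw [← integral_lineDeriv_mul_max_sub_norm μ hg v hR.1]
    refine setIntegral_eq_integral_of_forall_compl_eq_zero fun u hu ↦ ?_
    rw [mem_ball_zero_iff, not_lt] at hu
    rw [max_eq_right (by linarith [hR.2]), mul_zero]
  have key := hL.unique (hR.congr_of_eventuallyEq heq)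
  simp only [one_pow, one_mul, one_smul] at key
  rw [← key, ← integral_indicator measurableSet_ball, ← integral_indicator measurableSet_ball]
  congr 1 with u
  by_cases h1 : ‖u‖ < 1
  · simp [indicator, h1, h1.trans one_lt_two]
  · simp [indicator, h1]

end Divergence

section Smoothing

variable {E : Type*} [NormedAddCommGroup E] [NormedSpace ℝ E]

theorem LipschitzWith.comp_add_smul {L : ℝ≥0} {f : E → ℝ} (hf : LipschitzWith L f) (δ : ℝ)
    (x : E) : LipschitzWith (L * ‖δ‖₊) fun u ↦ f (x + δ • u) := by
  simpa [Function.comp_def] using hf.comp ((LipschitzWith.const x).add (lipschitzWith_smul δ))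

theorem DifferentiableAt.lineDeriv_comp_add_smul {f : E → ℝ} {δ : ℝ} {x u : E}
    (hf : DifferentiableAt ℝ f (x + δ • u)) (v : E) :
    lineDeriv ℝ (fun u ↦ f (x + δ • u)) u v = δ * fderiv ℝ f (x + δ • u) v := by
  have h : HasFDerivAt (fun u : E ↦ x + δ • u) (δ • ContinuousLinearMap.id ℝ E) u :=
    ((hasFDerivAt_id u).const_smul δ).const_add x
  refine ((hf.hasFDerivAt.comp u h).hasLineDerivAt v).lineDeriv.trans ?_
  simp

variable [FiniteDimensional ℝ E] [MeasurableSpace E] [BorelSpace E]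
  (μ : Measure E) [μ.IsAddHaarMeasure]

theorem LipschitzWith.ae_differentiableAt_add_smul {L : ℝ≥0} {f : E → ℝ} (hf : LipschitzWith L f)
    {δ : ℝ} (hδ : δ ≠ 0) (x : E) : ∀ᵐ u ∂μ, DifferentiableAt ℝ f (x + δ • u) := by
  filter_upwards [(hf.comp_add_smul δ x).ae_differentiableAt (μ := μ)] with u hu
  have hfg : f = (fun u ↦ f (x + δ • u)) ∘ fun y ↦ δ⁻¹ • (y - x) := by
    ext y
    simp [smul_smul, hδ]
  rw [hfg]
  refine DifferentiableAt.comp _ ?_ (by fun_prop)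
  simpa [smul_smul, hδ] using hu

theorem hasFDerivAt_setIntegral_closedBall {L : ℝ≥0} {f : E → ℝ} (hf : LipschitzWith L f)
    {δ : ℝ} (hδ : δ ≠ 0) (x : E) :
    IntegrableOn (fun u ↦ fderiv ℝ f (x + δ • u)) (closedBall 0 1) μ ∧
    HasFDerivAt (fun y ↦ ∫ u in closedBall (0 : E) 1, f (y + δ • u) ∂μ)
      (∫ u in closedBall (0 : E) 1, fderiv ℝ f (x + δ • u) ∂μ) x := by
  have hfin : IsFiniteMeasure (μ.restrict (closedBall (0 : E) 1)) :=
    ⟨by simpa using measure_closedBall_lt_top⟩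
  have hcont (y : E) : Continuous fun u ↦ f (y + δ • u) :=
    hf.continuous.comp (by fun_prop)
  refine hasFDerivAt_integral_of_dominated_loc_of_lip (bound := fun _ ↦ (L : ℝ)) univ_mem
    (.of_forall fun y ↦ (hcont y).aestronglyMeasurable) 
    ((hcont x).continuousOn.integrableOn_compact (isCompact_closedBall 0 1))
    ?_ (.of_forall fun u ↦ ?_) (integrable_const _) ?_
  · exact ((measurable_fderiv ℝ f).comp
      (by fun_prop : Measurable fun u ↦ x + δ • u)).aestronglyMeasurable
  · rw [Real.nnabs_coe]
    refine LipschitzWith.lipschitzOnWith (LipschitzWith.of_dist_le_mul fun a b ↦ ?_)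
    simpa using hf.dist_le_mul (a + δ • u) (b + δ • u)
  · filter_upwards [ae_restrict_of_ae (hf.ae_differentiableAt_add_smul μ hδ x)] with u hu
    exact (hasFDerivAt_comp_add_right (δ • u)).2 hu.hasFDerivAt

end Smoothing

/-- Lemma 1 (one-point gradient estimator): if `f : ℝⁿ → ℝ` is Lipschitz continuous and
`δ ∈ (0,1)`, then the `δ`-smoothed version `f̂_δ` is differentiable at every `x` with
gradient `∇f̂_δ(x) = E_{u ∼ Unif(𝕊ⁿ⁻¹)}[(n/δ) f(x + δu) u]`. -/
theorem one_point_gradient_estimator (n : ℕ) (hn : 1 ≤ n) (L : NNReal)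
    (f : EuclideanSpace ℝ (Fin n) → ℝ) (hf : LipschitzWith L f)
    (δ : ℝ) (hδ : 0 < δ) (hδ1 : δ < 1) (x : EuclideanSpace ℝ (Fin n)) :
    HasGradientAt (smoothed n f δ)
      (∫ u, (((n : ℝ) / δ) * f (x + δ • u)) • u ∂(uniformSphere n)) x := by
  have : NeZero n := ⟨by omega⟩
  have : Nontrivial (EuclideanSpace ℝ (Fin n)) :=
    Module.nontrivial_of_finrank_pos (R := ℝ) (by simp; omega)
  obtain ⟨hint, hderiv⟩ := hasFDerivAt_setIntegral_closedBall volume hf hδ.ne' x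
  set b : ℝ := (volume : Measure (EuclideanSpace ℝ (Fin n))).real (ball 0 1) with hb
  have hb0 : b ≠ 0 := (ENNReal.toReal_pos (measure_ball_pos _ _ one_pos).ne'
    measure_ball_lt_top.ne).ne'
  have hball : (volume (closedBall (0 : EuclideanSpace ℝ (Fin n)) 1))⁻¹.toReal = b⁻¹ := by
    rw [ENNReal.toReal_inv, Measure.addHaar_closedBall_eq_addHaar_ball, hb, measureReal_def]
  have hsphere : ((volume : Measure (EuclideanSpace ℝ (Fin n))).toSphere univ)⁻¹.toReal =
      (n * b)⁻¹ := by
    rw [ENNReal.toReal_inv, ← measureReal_def, Measure.toSphere_real_apply_univ, hb,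
      finrank_euclideanSpace_fin]
  have hsmooth : smoothed n f δ = fun y ↦ b⁻¹ •
      ∫ u in closedBall (0 : EuclideanSpace ℝ (Fin n)) 1, f (y + δ • u) := by
    ext y
    rw [smoothed, uniformBall, integral_smul_measure, hball]
  have hgrad : ∫ u, (((n : ℝ) / δ) * f (x + δ • u)) • u ∂(uniformSphere n) =
      (n * b)⁻¹ • ∫ ω : sphere (0 : EuclideanSpace ℝ (Fin n)) 1,
        ((n : ℝ) / δ * f (x + δ • (ω : EuclideanSpace ℝ (Fin n)))) •
          (ω : EuclideanSpace ℝ (Fin n)) ∂(volume.toSphere) := by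
    rw [uniformSphere, integral_smul_measure, hsphere,
      (MeasurableEmbedding.subtype_coe isClosed_sphere.measurableSet).integral_map]
  rw [hasGradientAt_iff_hasFDerivAt, hsmooth, hgrad]
  refine (hderiv.const_smul b⁻¹).congr_fderiv (ContinuousLinearMap.ext fun v ↦ ?_)
  have hcont : Continuous fun ω : sphere (0 : EuclideanSpace ℝ (Fin n)) 1 ↦
      ((n : ℝ) / δ * f (x + δ • (ω : EuclideanSpace ℝ (Fin n)))) •
        (ω : EuclideanSpace ℝ (Fin n)) := by
    have := hf.continuous
    fun_prop
  have hdiv := setIntegral_ball_lineDeriv_eq volume (hf.comp_add_smul δ x) v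
  have hlin : ∫ u in ball (0 : EuclideanSpace ℝ (Fin n)) 1,
      lineDeriv ℝ (fun u ↦ f (x + δ • u)) u v =
      δ * ∫ u in ball (0 : EuclideanSpace ℝ (Fin n)) 1, fderiv ℝ f (x + δ • u) v := by
    rw [← integral_const_mul]
    refine integral_congr_ae ?_
    filter_upwards [ae_restrict_of_ae (hf.ae_differentiableAt_add_smul volume hδ.ne' x)] with u hu
    exact hu.lineDeriv_comp_add_smul v
  rw [smul_apply, ContinuousLinearMap.integral_apply hint,
    InnerProductSpace.toDual_apply_apply, real_inner_smul_left, real_inner_comm,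
    ← integral_inner (hcont.integrable_of_hasCompactSupport (.of_compactSpace _))]
  simp only [real_inner_smul_right, mul_assoc]
  rw [integral_const_mul]
  simp only [real_inner_comm v] at hdiv ⊢
  have hset : closedBall (0 : EuclideanSpace ℝ (Fin n)) 1 =ᵐ[volume] ball 0 1 :=
    (ae_eq_of_subset_of_measure_ge ball_subset_closedBall
      (Measure.addHaar_closedBall_eq_addHaar_ball volume 0 1).le
      measurableSet_ball.nullMeasurableSet measure_closedBall_lt_top.ne).symm
  rw [setIntegral_congr_set hset]
  have hn0 : (n : ℝ) ≠ 0 := by positivity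
  rw [smul_eq_mul, ← hdiv, hlin]
  field_simp
end
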